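/- If φ ∈ UID(U), then for every open V ⋐ U one has the following uniform little Hölder property along vertical directions: lim_{ρ→0} sup{ |φ(w + t e_{y_i}) − φ(w + s e_{y_i})| / |t − s|^{1/2} : i ∈ {1,…,h}, the segment from w + s e_{y_i} to w + t e_{y_i} is contained in V, 0 < |t − s| ≤ ρ } = 0, where e_{y_i} is the unit vector in the y_i-direction. -/

import Mathlib

open MeasureTheory Filter Topology

namespace Step2

/-- The underlying space of the step-2 Carnot group `G = ℝ^m × ℝ^h`. -/
abbrev G (m h : ℕ) := (Fin m → ℝ) × (Fin h → ℝ)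

variable {m h : ℕ}

/-- Group product `(x,y)·(x',y') = (x+x', y+y' - (1/2)⟨Bx,x'⟩)`. -/
noncomputable def gmul (B : Fin h → Matrix (Fin m) (Fin m) ℝ) (p q : G m h) : G m h :=
  (p.1 + q.1, fun i => p.2 i + q.2 i - (1 / 2) * ∑ j, ∑ k, B i j k * p.1 k * q.1 j)

/-- Group inverse `g⁻¹ = -g`. -/
def ginv (p : G m h) : G m h := (-p.1, -p.2)

/-- Homogeneous norm `‖(x,y)‖ = Σ|x_j| + Σ|y_i|^(1/2)`. -/
noncomputable def hnorm (p : G m h) : ℝ :=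
  (∑ j, |p.1 j|) + ∑ i, Real.sqrt |p.2 i|

/-- Homogeneous (quasi-)distance `d(p,q) = ‖p⁻¹·q‖`. -/
noncomputable def gdist (B : Fin h → Matrix (Fin m) (Fin m) ℝ) (p q : G m h) : ℝ :=
  hnorm (gmul B (ginv p) q)

/-- Euclidean distance on `G`. -/
noncomputable def eDist (p q : G m h) : ℝ :=
  Real.sqrt ((∑ j, (p.1 j - q.1 j) ^ 2) + ∑ i, (p.2 i - q.2 i) ^ 2)

/-- The subgroup `W = {x_1 = 0}`. -/
def Wset (m h : ℕ) [NeZero m] : Set (G m h) := {p | p.1 0 = 0}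

/-- `U` is (relatively) open in `W`. -/
def RelOpen (m h : ℕ) [NeZero m] (U : Set (G m h)) : Prop :=
  ∃ O : Set (G m h), IsOpen O ∧ U = O ∩ Wset m h

/-- The graphing map `Φ(w) = (φ(w),0,…,0) ∈ L`. -/
noncomputable def Phi [NeZero m] (φ : G m h → ℝ) (w : G m h) : G m h :=
  ((fun j => if j = 0 then φ w else 0), 0)

/-- Horizontal coordinate vector `e_{x_j}`. -/
def eH (m h : ℕ) (j : Fin m) : G m h := ((fun j' => if j' = j then 1 else 0), 0)

/-- Vertical coordinate vector `e_{y_i}`. -/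
def eV (m h : ℕ) (i : Fin h) : G m h := (0, fun i' => if i' = i then 1 else 0)

/-- The projected vector field `D^φ_j` (for `j ≠ 0`, i.e. `j = 2,…,m` in 1-based indexing):
`D^φ_j|_w = ∂_{x_j} - Σ_i ( b^(i)_{j1} φ(w) + (1/2) Σ_{k≥2} x_k b^(i)_{jk} ) ∂_{y_i}`. -/
noncomputable def Dvec [NeZero m] (B : Fin h → Matrix (Fin m) (Fin m) ℝ)
    (φ : G m h → ℝ) (j : Fin m) (w : G m h) : G m h :=
  ((fun j' => if j' = j then 1 else 0),
   fun i => -(B i j 0 * φ w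
      + (1 / 2) * ∑ k ∈ Finset.univ.erase (0 : Fin m), w.1 k * B i j k))

/-- `D^φφ = ω` in the broad* sense on `U`. -/
def IsBroadStar [NeZero m] (B : Fin h → Matrix (Fin m) (Fin m) ℝ) (U : Set (G m h))
    (φ : G m h → ℝ) (ω : G m h → Fin m → ℝ) : Prop :=
  ∀ a₀ ∈ U, ∃ δ₁ δ₂ : ℝ, 0 < δ₂ ∧ δ₂ < δ₁ ∧
    ∀ j : Fin m, j ≠ 0 → ∃ E : G m h → ℝ → G m h,
      ∀ a, a ∈ U → eDist a a₀ ≤ δ₂ →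
        (∀ t ∈ Set.Icc (-δ₂) δ₂, E a t ∈ U ∧ eDist (E a t) a₀ ≤ δ₁) ∧
        E a 0 = a ∧
        (∀ t ∈ Set.Icc (-δ₂) δ₂,
          HasDerivWithinAt (E a) (Dvec B φ j (E a t)) (Set.Icc (-δ₂) δ₂) t) ∧
        (∀ t ∈ Set.Icc (-δ₂) δ₂, φ (E a t) - φ a = ∫ s in (0:ℝ)..t, ω (E a s) j)

/-- `φ` is vertically broad* Hölder on `U`. -/
def VertHolder (m h : ℕ) [NeZero m] (U : Set (G m h)) (φ : G m h → ℝ) : Prop :=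
  ∀ a₀ ∈ U, ∃ U' : Set (G m h), RelOpen m h U' ∧ a₀ ∈ U' ∧
    IsCompact (closure U') ∧ closure U' ⊆ U ∧
    ∀ i : Fin h, ∀ ε > (0:ℝ), ∃ ρ > (0:ℝ), ∀ p ∈ U', ∀ q ∈ U',
      p.1 = q.1 → (∀ i' : Fin h, i' ≠ i → p.2 i' = q.2 i') →
      0 < |p.2 i - q.2 i| → |p.2 i - q.2 i| ≤ ρ →
      |φ p - φ q| ≤ ε * Real.sqrt |p.2 i - q.2 i|

/-- The translated point `Φ(a)⁻¹·a⁻¹·b·Φ(a)`. -/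
noncomputable def shiftQ [NeZero m] (B : Fin h → Matrix (Fin m) (Fin m) ℝ)
    (φ : G m h → ℝ) (a b : G m h) : G m h :=
  gmul B (gmul B (gmul B (ginv (Phi φ a)) (ginv a)) b) (Phi φ a)

/-- `φ` is intrinsically differentiable at `a₀` with intrinsic gradient `grad`. -/
def IDAt [NeZero m] (B : Fin h → Matrix (Fin m) (Fin m) ℝ) (U : Set (G m h))
    (φ : G m h → ℝ) (a₀ : G m h) (grad : Fin m → ℝ) : Prop :=
  ∀ ε > (0:ℝ), ∃ r > (0:ℝ), ∀ b ∈ U, 0 < gdist B a₀ b → gdist B a₀ b < r →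
    |φ b - φ a₀ - ∑ j ∈ Finset.univ.erase (0 : Fin m), grad j * (b.1 j - a₀.1 j)|
      ≤ ε * hnorm (shiftQ B φ a₀ b)

/-- `φ` is uniformly intrinsically differentiable at `a₀` with intrinsic gradient `grad`. -/
def UIDAt [NeZero m] (B : Fin h → Matrix (Fin m) (Fin m) ℝ) (U : Set (G m h))
    (φ : G m h → ℝ) (a₀ : G m h) (grad : Fin m → ℝ) : Prop :=
  ∀ ε > (0:ℝ), ∃ r > (0:ℝ), ∀ a ∈ U, ∀ b ∈ U,
    gdist B a₀ a < r → gdist B a₀ b < r → a ≠ b →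
    |φ b - φ a - ∑ j ∈ Finset.univ.erase (0 : Fin m), grad j * (b.1 j - a.1 j)|
      ≤ ε * hnorm (shiftQ B φ a b)

/-- Projection onto `L` in the splitting `G = W·L`. -/
def piL (m h : ℕ) [NeZero m] (g : G m h) : G m h :=
  ((fun j => if j = 0 then g.1 0 else 0), 0)

/-- Projection onto `W` in the splitting `G = W·L`. -/
noncomputable def piW [NeZero m] (B : Fin h → Matrix (Fin m) (Fin m) ℝ) (g : G m h) : G m h :=
  ((fun j => if j = 0 then 0 else g.1 j),
   fun i => g.2 i + (1 / 2) * g.1 0 * ∑ k ∈ Finset.univ.erase (0 : Fin m), B i 0 k * g.1 k)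

/-- Coordinates `ℝ^(m-1) × ℝ^h → W ⊆ G`. -/
def emb (m h : ℕ) (u : (Fin (m - 1) → ℝ) × (Fin h → ℝ)) : G m h :=
  ((fun j => if hj : (j : ℕ) = 0 then 0
      else u.1 ⟨(j : ℕ) - 1, by have := j.isLt; omega⟩), u.2)

/-- The Lebesgue measure on `W`, as a measure on `G`. -/
noncomputable def muW (m h : ℕ) : Measure (G m h) :=
  Measure.map (emb m h) volume

end Step2

namespace Step2

/-- A skew-symmetric matrix defines an alternating bilinear form. -/
theorem dotProduct_mulVec_self_of_skew {M : Matrix (Fin m) (Fin m) ℝ} (hM : M.transpose = -M)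
    (v : Fin m → ℝ) : v ⬝ᵥ M.mulVec v = 0 := by
  have h1 : v ⬝ᵥ M.mulVec v = v ⬝ᵥ M.transpose.mulVec v := by
    rw [Matrix.mulVec_transpose, Matrix.dotProduct_mulVec, dotProduct_comm]
  rw [hM, Matrix.neg_mulVec, dotProduct_neg] at h1
  linarith

theorem gmul_snd (B : Fin h → Matrix (Fin m) (Fin m) ℝ) (p q : G m h) (i : Fin h) :
    (gmul B p q).2 i = p.2 i + q.2 i - (1 / 2) * (q.1 ⬝ᵥ (B i).mulVec p.1) := by
  simp only [gmul, Matrix.mulVec, dotProduct, Finset.mul_sum]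
  congr 1
  refine Finset.sum_congr rfl fun j _ => Finset.sum_congr rfl fun k _ => ?_
  ring

/-- Vertical displacements are central, so conjugating them by the graph map does nothing. -/
theorem shiftQ_of_fst_eq [NeZero m] {B : Fin h → Matrix (Fin m) (Fin m) ℝ}
    (hskew : ∀ i, (B i).transpose = -B i) (φ : G m h → ℝ) {a b : G m h} (hab : a.1 = b.1) :
    shiftQ B φ a b = (0, b.2 - a.2) := by
  refine Prod.ext ?_ (funext fun i => ?_)
  · simp [shiftQ, gmul, ginv, hab]
  · have h1 := dotProduct_mulVec_self_of_skew (hskew i) b.1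
    have h2 := dotProduct_mulVec_self_of_skew (hskew i) (Phi φ a).1
    have h3 : (Phi φ a).2 i = 0 := rfl
    rw [shiftQ, gmul_snd, gmul_snd, gmul_snd]
    simp only [gmul, ginv, hab, h3, Pi.neg_apply, Pi.sub_apply, Matrix.mulVec_add,
      Matrix.mulVec_neg, dotProduct_add, dotProduct_neg, neg_dotProduct, h1, h2]
    ring

theorem hnorm_smul_eV (τ : ℝ) (i : Fin h) : hnorm (τ • eV m h i) = Real.sqrt |τ| := by
  simp only [hnorm, eV, Prod.smul_mk, smul_zero, Pi.zero_apply, abs_zero, Finset.sum_const_zero,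
    zero_add, Pi.smul_apply, smul_eq_mul]
  rw [Finset.sum_eq_single i] <;> simp +contextual

theorem continuous_gdist (B : Fin h → Matrix (Fin m) (Fin m) ℝ) (a₀ : G m h) :
    Continuous (gdist B a₀) := by
  unfold gdist hnorm gmul
  fun_prop

theorem gdist_self {B : Fin h → Matrix (Fin m) (Fin m) ℝ}
    (hskew : ∀ i, (B i).transpose = -B i) (a : G m h) : gdist B a a = 0 := by
  have h2 (i : Fin h) : (gmul B (ginv a) a).2 i = 0 := by
    rw [gmul_snd]
    simp [ginv, Matrix.mulVec_neg, dotProduct_mulVec_self_of_skew (hskew i)]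
  simp only [gdist, hnorm, h2]
  simp [gmul, ginv]

theorem norm_eV_le (i : Fin h) : ‖eV m h i‖ ≤ 1 := by
  simp only [eV, Prod.norm_mk, norm_zero]
  refine max_le zero_le_one ((pi_norm_le_iff_of_nonneg zero_le_one).2 fun j => ?_)
  split_ifs <;> simp

/-- If `φ ∈ UID(U)`, then on every relatively open `V ⋐ U` one has the
uniform `(1/2)`-little Hölder property along vertical directions. -/
theorem statement5 (m h : ℕ) [NeZero m] (hm : 2 ≤ m) (hh : 1 ≤ h)
    (B : Fin h → Matrix (Fin m) (Fin m) ℝ)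
    (hskew : ∀ i, (B i).transpose = - B i) (hBli : LinearIndependent ℝ B)
    (U : Set (G m h)) (hUW : U ⊆ Wset m h) (hUopen : RelOpen m h U)
    (φ : G m h → ℝ) (hφ : ContinuousOn φ U)
    (hUID : ∀ a₀ ∈ U, ∃ grad : Fin m → ℝ, UIDAt B U φ a₀ grad) :
    ∀ V : Set (G m h), RelOpen m h V → IsCompact (closure V) → closure V ⊆ U →
      ∀ ε > (0:ℝ), ∃ ρ > (0:ℝ), ∀ i : Fin h, ∀ w : G m h, ∀ s t : ℝ,
        (∀ r ∈ Set.uIcc s t, w + r • eV m h i ∈ V) →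
        0 < |t - s| → |t - s| ≤ ρ →
        |φ (w + t • eV m h i) - φ (w + s • eV m h i)| ≤ ε * Real.sqrt |t - s| := by
  intro V _ hVc hVU ε hε
  choose! grad hgrad using hUID
  have hr : ∀ a₀ ∈ U, ∃ r > (0:ℝ), ∀ a ∈ U, ∀ b ∈ U,
      gdist B a₀ a < r → gdist B a₀ b < r → a ≠ b →
      |φ b - φ a - ∑ j ∈ Finset.univ.erase (0 : Fin m), grad a₀ j * (b.1 j - a.1 j)|
        ≤ ε * hnorm (shiftQ B φ a b) := fun a₀ ha₀ => hgrad a₀ ha₀ ε hε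
  choose! r hr0 hr using hr
  obtain ⟨δ, hδ, hball⟩ := lebesgue_number_lemma_of_metric
    (c := fun x : closure V => {a : G m h | gdist B x a < r x}) hVc
    (fun x => isOpen_lt (continuous_gdist B x) continuous_const)
    (fun x hx => Set.mem_iUnion.2 ⟨⟨x, hx⟩, by
      simpa [gdist_self hskew] using hr0 x (hVU hx)⟩)
  refine ⟨δ / 2, half_pos hδ, fun i w s t hseg hpos hle => ?_⟩
  have ha := subset_closure (hseg s Set.left_mem_uIcc)
  have hb := subset_closure (hseg t Set.right_mem_uIcc)
  have hsub : (w + t • eV m h i) - (w + s • eV m h i) = (t - s) • eV m h i := by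
    rw [sub_smul]; abel
  have hfst : (w + s • eV m h i).1 = (w + t • eV m h i).1 := by simp [eV]
  have hshift : shiftQ B φ (w + s • eV m h i) (w + t • eV m h i) = (t - s) • eV m h i := by
    rw [shiftQ_of_fst_eq hskew φ hfst, ← hsub]
    exact Prod.ext (by rw [Prod.fst_sub, hfst, sub_self]) rfl
  have hdist : dist (w + t • eV m h i) (w + s • eV m h i) < δ := by
    rw [dist_eq_norm, hsub, norm_smul, Real.norm_eq_abs]
    nlinarith [norm_eV_le (m := m) i]
  have hne : w + s • eV m h i ≠ w + t • eV m h i := fun heq => by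
    have h0 := hnorm_smul_eV (m := m) (t - s) i
    rw [← hsub, heq, sub_self] at h0
    have : 0 < Real.sqrt |t - s| := Real.sqrt_pos.2 hpos
    simp [hnorm] at h0
    linarith
  obtain ⟨x, hx⟩ := hball _ ha
  have key := hr x (hVU x.2) _ (hVU ha) _ (hVU hb) (hx (Metric.mem_ball_self hδ)) (hx hdist) hne
  rw [hshift, hnorm_smul_eV, hfst] at key
  simpa using key

end Step2
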